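/- There is no collection F of functions f : 2^{<ω} → ℕ such that the intersection LK(F) = ⋂_{f∈F} LK(f) equals KT(Δ⁰₂). -/

import Mathlib

/-! Common framework: prefix-free Kolmogorov complexity via a universal
prefix-free oracle machine, Δ⁰₂ functions and orders, Turing and wtt
reducibility, Ω, and the uniform measure on Cantor space. -/

/-- Finite binary strings, `2^{<ω}`. -/
abbrev BinStr := List Bool

/-- Reals, i.e. infinite binary sequences `2^ω`. -/
abbrev Seq2 := ℕ → Bool

/-- The initial segment `A↾n` of a real `A ∈ 2^ω`. -/
def restrict (A : Seq2) (n : ℕ) : BinStr := (List.range n).map A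

/-- A prefix-free oracle machine, presented as a computable enumeration of
axioms `(τ, p, y)`, meaning: on any oracle extending `τ`, the machine halts on
program `p` with output `y`.  Consistency says that for compatible oracle
strings the halting programs form a prefix-free set and outputs are unique. -/
structure PrefixOracleMachine where
  axioms : ℕ → Option (BinStr × BinStr × BinStr)
  axioms_computable : Computable axioms
  consistent : ∀ s t τ₁ p₁ y₁ τ₂ p₂ y₂,
    axioms s = some (τ₁, p₁, y₁) → axioms t = some (τ₂, p₂, y₂) →
    (τ₁ <+: τ₂ ∨ τ₂ <+: τ₁) → p₁ <+: p₂ → p₁ = p₂ ∧ y₁ = y₂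

/-- `M.Computes A p y` : with oracle `A`, machine `M` halts on program `p` with
output `y`. -/
def PrefixOracleMachine.Computes (M : PrefixOracleMachine) (A : Seq2) (p y : BinStr) : Prop :=
  ∃ s τ, M.axioms s = some (τ, p, y) ∧ ∃ n, τ = restrict A n

/-- A universal prefix-free oracle machine: it describes every string (relative
to every oracle), and it simulates every prefix-free oracle machine up to an
additive constant in the length of programs. -/
structure UniversalPrefixMachine extends PrefixOracleMachine where
  total : ∀ (A : Seq2) (y : BinStr), ∃ p, toPrefixOracleMachine.Computes A p y
  universal : ∀ M : PrefixOracleMachine, ∃ c : ℕ, ∀ (A : Seq2) (p y : BinStr),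
    M.Computes A p y →
      ∃ q, toPrefixOracleMachine.Computes A q y ∧ q.length ≤ p.length + c

/-- `K^A(y)` : prefix-free Kolmogorov complexity of `y` relative to oracle `A`. -/
noncomputable def KOr (U : UniversalPrefixMachine) (A : Seq2) (y : BinStr) : ℕ :=
  sInf {n | ∃ p : BinStr, p.length = n ∧ U.toPrefixOracleMachine.Computes A p y}

/-- The all-zeros (recursive) oracle. -/
def zeroSeq : Seq2 := fun _ => false

/-- `K(y)` : (unrelativized) prefix-free Kolmogorov complexity. -/
noncomputable def Kc (U : UniversalPrefixMachine) (y : BinStr) : ℕ := KOr U zeroSeq y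

/-- `K(n)` : the complexity of the string of `n` zeros. -/
noncomputable def KcNat (U : UniversalPrefixMachine) (n : ℕ) : ℕ :=
  Kc U (List.replicate n false)

/-- `A ∈ KT(g)` : `A` is K-trivial up to `g`. -/
def KT (U : UniversalPrefixMachine) (g : ℕ → ℕ) (A : Seq2) : Prop :=
  ∃ c : ℕ, ∀ n : ℕ, Kc U (restrict A n) ≤ KcNat U n + g n + c

/-- `A ∈ LK(f)` : `A` is low for K up to `f`. -/
def LK (U : UniversalPrefixMachine) (f : BinStr → ℕ) (A : Seq2) : Prop :=
  ∃ c : ℕ, ∀ σ : BinStr, Kc U σ ≤ KOr U A σ + f σ + c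

/-- The position of a string in the length-lexicographic ordering of `2^{<ω}`. -/
def strNum (σ : BinStr) : ℕ := σ.foldl (fun n b => 2 * n + (if b then 2 else 1)) 0

/-- A function `ℕ → ℕ` is Δ⁰₂ iff it has a recursive approximation. -/
def Delta02Fun (g : ℕ → ℕ) : Prop :=
  ∃ G : ℕ → ℕ → ℕ, Computable₂ G ∧ ∀ x, ∃ t, ∀ s ≥ t, G s x = g x

/-- A function `2^{<ω} → ℕ` is Δ⁰₂ iff it has a recursive approximation. -/
def Delta02StrFun (f : BinStr → ℕ) : Prop :=
  ∃ F : ℕ → BinStr → ℕ, Computable₂ F ∧ ∀ σ, ∃ t, ∀ s ≥ t, F s σ = f σ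

/-- A real is Δ⁰₂ iff it has a recursive approximation. -/
def Delta02Seq (A : Seq2) : Prop :=
  ∃ F : ℕ → ℕ → Bool, Computable₂ F ∧ ∀ x, ∃ t, ∀ s ≥ t, F s x = A x

/-- An order: an unbounded nondecreasing function `ℕ → ℕ`. -/
def IsOrder (g : ℕ → ℕ) : Prop := Monotone g ∧ ∀ b : ℕ, ∃ m, b < g m

/-- An order on strings: unbounded and nondecreasing with respect to the
length-lexicographic ordering of `2^{<ω}`. -/
def IsStrOrder (f : BinStr → ℕ) : Prop :=
  (∀ σ τ : BinStr, strNum σ ≤ strNum τ → f σ ≤ f τ) ∧ ∀ b : ℕ, ∃ σ, b < f σ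

/-- `A ∈ KT(Δ⁰₂)` : `A` is K-trivial up to every Δ⁰₂ order. -/
def KTDelta (U : UniversalPrefixMachine) (A : Seq2) : Prop :=
  ∀ g : ℕ → ℕ, Delta02Fun g → IsOrder g → KT U g A

/-- `A ∈ LK(Δ⁰₂)` : `A` is low for K up to every Δ⁰₂ order. -/
def LKDelta (U : UniversalPrefixMachine) (A : Seq2) : Prop :=
  ∀ f : BinStr → ℕ, Delta02StrFun f → IsStrOrder f → LK U f A

/-- A Δ⁰₂ function is finite-to-one approximable if it has a recursive
approximation `F` such that for every `n`, for all but finitely many `m`,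
`F s m > n` for all stages `s`. -/
def FinToOneApprox (f : ℕ → ℕ) : Prop :=
  ∃ F : ℕ → ℕ → ℕ, Computable₂ F ∧ (∀ x, ∃ t, ∀ s ≥ t, F s x = f x) ∧
    ∀ n : ℕ, {m : ℕ | ∃ s, F s m ≤ n}.Finite

/-- A Turing functional, presented as a computable enumeration of axioms
`(τ, n, b)`, meaning: on any oracle extending `τ`, the output bit `n` is `b`. -/
structure TuringFunctional where
  axioms : ℕ → Option (BinStr × ℕ × Bool)
  axioms_computable : Computable axioms
  consistent : ∀ s t τ₁ n₁ b₁ τ₂ n₂ b₂,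
    axioms s = some (τ₁, n₁, b₁) → axioms t = some (τ₂, n₂, b₂) →
    (τ₁ <+: τ₂ ∨ τ₂ <+: τ₁) → n₁ = n₂ → b₁ = b₂

/-- `Φ.Computes B A` : `Φ^B = A`. -/
def TuringFunctional.Computes (Φ : TuringFunctional) (B A : Seq2) : Prop :=
  ∀ n : ℕ, ∃ s k, Φ.axioms s = some (restrict B k, n, A n)

/-- Turing reducibility `A ≤_T B`. -/
def TuringLE (A B : Seq2) : Prop := ∃ Φ : TuringFunctional, Φ.Computes B A

/-- Weak truth-table reducibility `A ≤_wtt B` : a Turing reduction whose use is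
bounded by a recursive function. -/
def WttLE (A B : Seq2) : Prop :=
  ∃ (Φ : TuringFunctional) (u : ℕ → ℕ), Computable u ∧
    ∀ n : ℕ, ∃ s k, k ≤ u n ∧ Φ.axioms s = some (restrict B k, n, A n)

/-- The effective join `A ⊕ B`. -/
def join (A B : Seq2) : Seq2 := fun n => if n % 2 = 0 then A (n / 2) else B (n / 2)

/-- `A` is Martin-Löf random: `K(A↾n) ≥ n - c` for all `n`. -/
def MLRandom (U : UniversalPrefixMachine) (A : Seq2) : Prop :=
  ∃ c : ℕ, ∀ n : ℕ, n ≤ Kc U (restrict A n) + c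

/-- `A` is infinitely often K-trivial. -/
def InfOftenKTrivial (U : UniversalPrefixMachine) (A : Seq2) : Prop :=
  ∃ c : ℕ, {n : ℕ | Kc U (restrict A n) ≤ KcNat U n + c}.Infinite

/-- K-reducibility `B ≤_K A`. -/
def KLE (U : UniversalPrefixMachine) (B A : Seq2) : Prop :=
  ∃ c : ℕ, ∀ n : ℕ, Kc U (restrict B n) ≤ Kc U (restrict A n) + c

/-- LK-reducibility `A ≤_LK B`. -/
def LKLE (U : UniversalPrefixMachine) (A B : Seq2) : Prop :=
  ∃ c : ℕ, ∀ σ : BinStr, KOr U B σ ≤ KOr U A σ + c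

/-- `A` is weakly low for K: `K(σ) ≤ K^A(σ) + c` for infinitely many strings σ. -/
def WeaklyLowForK (U : UniversalPrefixMachine) (A : Seq2) : Prop :=
  ∃ c : ℕ, {σ : BinStr | Kc U σ ≤ KOr U A σ + c}.Infinite

/-- Chaitin's Ω : the measure of the domain of the universal machine. -/
noncomputable def Omega (U : UniversalPrefixMachine) : ℝ :=
  ∑' p : {p : BinStr // ∃ y, U.toPrefixOracleMachine.Computes zeroSeq p y},
    ((2 : ℝ) ^ (p : BinStr).length)⁻¹

/-- The `n`-th binary digit of a real number `x`. -/
noncomputable def realBit (x : ℝ) (n : ℕ) : Bool :=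
  decide (⌊x * 2 ^ (n + 1)⌋ % 2 = 1)

/-- `Ω↾n` : the length-`n` initial segment of the binary expansion of Ω. -/
noncomputable def omegaStr (U : UniversalPrefixMachine) (n : ℕ) : BinStr :=
  (List.range n).map (realBit (Omega U))

/-- `A` is low for Ω. -/
def LowForOmega (U : UniversalPrefixMachine) (A : Seq2) : Prop :=
  ∀ c : ℕ, ∃ n : ℕ, KOr U A (omegaStr U n) + c < n

/-- The uniform (coin-flipping) measure on `2^ω`, obtained as the image of
Lebesgue measure on `[0,1]` under the binary-expansion map. -/
noncomputable def cantorMeasure : MeasureTheory.Measure Seq2 :=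
  MeasureTheory.Measure.map (fun x : ℝ => fun n : ℕ => realBit x n)
    (MeasureTheory.volume.restrict (Set.Icc (0 : ℝ) 1))

/-! ### Restrictions and chains of strings -/

@[simp] lemma length_restrict (A : Seq2) (n : ℕ) : (restrict A n).length = n := by
  simp [restrict]

lemma restrict_succ (A : Seq2) (n : ℕ) : restrict A (n + 1) = restrict A n ++ [A n] := by
  simp [restrict, List.range_succ]

lemma restrict_congr {A B : Seq2} {n : ℕ} (h : ∀ k < n, A k = B k) :
    restrict A n = restrict B n :=
  List.map_congr_left fun k hk => h k (List.mem_range.1 hk)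

lemma restrict_mono (A : Seq2) {m n : ℕ} (h : m ≤ n) : restrict A m <+: restrict A n := by
  induction n, h using Nat.le_induction with
  | base => exact List.prefix_rfl
  | succ n _ ih => rw [restrict_succ]; exact ih.trans (List.prefix_append _ _)

lemma restrict_compatible (A : Seq2) (m n : ℕ) :
    restrict A m <+: restrict A n ∨ restrict A n <+: restrict A m :=
  (le_total m n).imp (restrict_mono A) (restrict_mono A)

lemma restrict_getD (σ : BinStr) : restrict (fun k => σ.getD k false) σ.length = σ := by
  refine List.ext_getElem (by simp) fun i hi _ => ?_
  simp only [length_restrict] at hi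
  simp [restrict, hi]

lemma prefix_getD {σ τ : BinStr} (h : σ <+: τ) {k : ℕ} (hk : k < σ.length) :
    τ.getD k false = σ.getD k false := by
  obtain ⟨ρ, rfl⟩ := h
  simp [List.getElem?_append_left hk]

/-- A chain of strings whose lengths are unbounded has a limit real. -/
lemma exists_limit (σ : ℕ → BinStr) (hσ : ∀ i, σ i <+: σ (i + 1))
    (hlen : ∀ i, i ≤ (σ i).length) : ∃ A : Seq2, ∀ i, restrict A (σ i).length = σ i := by
  have mono : ∀ i j, i ≤ j → σ i <+: σ j := fun i j h => by
    induction j, h using Nat.le_induction with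
    | base => exact List.prefix_rfl
    | succ j _ ih => exact ih.trans (hσ j)
  refine ⟨fun n => (σ (n + 1)).getD n false, fun i => ?_⟩
  conv_rhs => rw [← restrict_getD (σ i)]
  refine restrict_congr fun k hk => ?_
  have hk' : k < (σ (k + 1)).length := hlen (k + 1)
  rcases le_total i (k + 1) with h | h
  · exact prefix_getD (mono _ _ h) hk
  · exact (prefix_getD (mono _ _ h) hk').symm

/-! ### Complexity bounds from machines -/

lemma KOr_le (U : UniversalPrefixMachine) {A : Seq2} {p y : BinStr}
    (h : U.toPrefixOracleMachine.Computes A p y) : KOr U A y ≤ p.length :=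
  Nat.sInf_le ⟨p, rfl, h⟩

lemma exists_program (U : UniversalPrefixMachine) (A : Seq2) (y : BinStr) :
    ∃ p : BinStr, p.length = KOr U A y ∧ U.toPrefixOracleMachine.Computes A p y :=
  Nat.sInf_mem (s := {n | ∃ p : BinStr, p.length = n ∧ U.toPrefixOracleMachine.Computes A p y})
    (let ⟨p, hp⟩ := U.total A y; ⟨p.length, p, rfl, hp⟩)

lemma exists_KOr_le (U : UniversalPrefixMachine) (M : PrefixOracleMachine) :
    ∃ c, ∀ A p y, M.Computes A p y → KOr U A y ≤ p.length + c := by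
  obtain ⟨c, hc⟩ := U.universal M
  refine ⟨c, fun A p y h => ?_⟩
  obtain ⟨q, hq, hqc⟩ := hc A p y h
  exact (KOr_le U hq).trans hqc

lemma PrefixOracleMachine.Computes.output_unique {M : PrefixOracleMachine} {A : Seq2}
    {p y z : BinStr} (hy : M.Computes A p y) (hz : M.Computes A p z) : y = z := by
  obtain ⟨s, _, hs, m, rfl⟩ := hy
  obtain ⟨t, _, ht, n, rfl⟩ := hz
  exact (M.consistent s t _ _ _ _ _ _ hs ht (restrict_compatible A m n) List.prefix_rfl).2

/-! ### Self-delimiting prefixes -/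

/-- The string `1ⁿ0q`. -/
def unaryCons (n : ℕ) (q : BinStr) : BinStr := List.replicate n true ++ false :: q

@[simp] lemma length_unaryCons (n : ℕ) (q : BinStr) :
    (unaryCons n q).length = n + 1 + q.length := by
  simp [unaryCons]; omega

lemma eq_and_prefix_of_unaryCons {m n : ℕ} {q r : BinStr}
    (h : unaryCons m q <+: unaryCons n r) :
    m = n ∧ q <+: r := by
  induction m generalizing n with
  | zero => cases n <;> simp_all [unaryCons, List.replicate_succ]
  | succ m ih =>
    cases n with
    | zero => simp [unaryCons, List.replicate_succ] at h
    | succ n =>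
      have := @ih n (by simpa [unaryCons, List.replicate_succ] using h)
      exact ⟨by rw [this.1], this.2⟩

lemma primrec_replicate (b : Bool) : Primrec fun n : ℕ => List.replicate n b :=
  (Primrec.list_map Primrec.list_range (Primrec.const b).to₂).of_eq fun n => by
    simp [List.map_const']

lemma primrec_unaryCons : Primrec₂ unaryCons :=
  Primrec.list_append.comp ((primrec_replicate true).comp Primrec.fst)
    (Primrec.list_cons.comp (Primrec.const false) Primrec.snd)

/-- The machine mapping `1ⁿ0` to `0^(n²)`. -/
def squareMachine : PrefixOracleMachine where
  axioms n := some ([], unaryCons n [], List.replicate (n * n) false)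
  axioms_computable := Primrec.to_comp <| Primrec.option_some.comp <|
    (Primrec.const []).pair <| (primrec_unaryCons.comp Primrec.id (Primrec.const [])).pair <|
      (primrec_replicate false).comp (Primrec.nat_mul.comp Primrec.id Primrec.id)
  consistent := by
    intro s t τ₁ p₁ y₁ τ₂ p₂ y₂ hs ht _ hp
    simp only [Option.some.injEq, Prod.mk.injEq] at hs ht
    obtain ⟨-, rfl, rfl⟩ := hs
    obtain ⟨-, rfl, rfl⟩ := ht
    obtain ⟨rfl, -⟩ := eq_and_prefix_of_unaryCons hp
    exact ⟨rfl, rfl⟩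

lemma exists_KcNat_sq_le (U : UniversalPrefixMachine) :
    ∃ c, ∀ n, KcNat U (n * n) ≤ n + c := by
  obtain ⟨c, hc⟩ := exists_KOr_le U squareMachine
  refine ⟨c + 1, fun n => ?_⟩
  have := hc zeroSeq (unaryCons n []) _ ⟨n, [], rfl, 0, rfl⟩
  simp only [length_unaryCons, List.length_nil] at this
  unfold KcNat Kc
  omega

/-! ### A real that is not `K`-trivial up to `n / 2` -/

lemma exists_complex_extension (U : UniversalPrefixMachine) (β : BinStr) (L : ℕ) :
    ∃ ρ : BinStr, ρ.length = L ∧ L ≤ Kc U (β ++ ρ) := by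
  by_contra! h
  have prog : ∀ v : List.Vector Bool L, ∃ p : Σ k : Fin L, List.Vector Bool k,
      U.toPrefixOracleMachine.Computes zeroSeq p.2.1 (β ++ v.1) := fun v => by
    obtain ⟨p, hp, hc⟩ := exists_program U zeroSeq (β ++ v.1)
    exact ⟨⟨⟨p.length, hp ▸ h v.1 v.2⟩, p, rfl⟩, hc⟩
  choose f hf using prog
  have inj : Function.Injective f := fun v w hvw => by
    have hw := hf w
    rw [← hvw] at hw
    exact Subtype.ext (List.append_cancel_left ((hf v).output_unique hw))
  have card := Fintype.card_le_of_injective f inj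
  have lt := Nat.geomSum_lt (m := 2) (n := L) (s := Finset.range L) le_rfl (by simp)
  simp only [card_vector, Fintype.card_bool, Fintype.card_sigma,
    Fin.sum_univ_eq_sum_range (fun k => 2 ^ k)] at card
  omega

lemma exists_extension_Kc_gt (U : UniversalPrefixMachine) (β : BinStr) (j : ℕ) :
    ∃ β' : BinStr, β <+: β' ∧ β.length < β'.length ∧
      KcNat U β'.length + β'.length / 2 + j < Kc U β' := by
  obtain ⟨c, hc⟩ := exists_KcNat_sq_le U
  set t := c + j + β.length + 2 with ht
  have hlt : 2 * (t * t) + 2 * t + c + j + β.length < 2 * t * (2 * t) := by nlinarith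
  obtain ⟨ρ, hρ, hK⟩ := exists_complex_extension U β (2 * t * (2 * t) - β.length)
  have hlen : (β ++ ρ).length = 2 * t * (2 * t) := by
    rw [List.length_append, hρ]; omega
  refine ⟨β ++ ρ, List.prefix_append _ _, by omega, ?_⟩
  rw [hlen]
  have := hc (2 * t)
  have hdiv : 2 * t * (2 * t) / 2 = 2 * (t * t) := by
    rw [show 2 * t * (2 * t) = 2 * (t * t) * 2 by ring]; simp
  omega

lemma exists_not_KTDelta (U : UniversalPrefixMachine) : ∃ B : Seq2, ¬ KTDelta U B := by
  choose next hpre hlt hK using exists_extension_Kc_gt U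
  let β : ℕ → BinStr := fun i => Nat.rec [] (fun j b => next b j) i
  have hβ : ∀ i, β (i + 1) = next (β i) i := fun i => rfl
  obtain ⟨B, hB⟩ := exists_limit β (fun i => hpre _ _) fun i => by
    induction i with
    | zero => exact Nat.zero_le _
    | succ i ih => exact ih.trans_lt (hlt (β i) i)
  refine ⟨B, fun h => ?_⟩
  obtain ⟨c, hc⟩ := h (fun n => n / 2)
    ⟨fun _ n => n / 2, (Primrec.nat_div.comp Primrec.snd (Primrec.const 2)).to_comp,
      fun _ => ⟨0, fun _ _ => rfl⟩⟩
    ⟨fun _ _ h => Nat.div_le_div_right h, fun b => ⟨2 * b + 2, show b < (2 * b + 2) / 2 by omega⟩⟩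
  have h1 := hc (β (c + 1)).length
  have h2 := hK (β c) c
  rw [hB (c + 1)] at h1
  rw [← hβ] at h2
  dsimp only at h1
  omega

/-! ### Computable moduli of convergence for `Δ⁰₂` orders -/

/-- The last stage up to `n` at which the sequence `f` has changed. -/
def lastChange (f : ℕ → ℕ) (n : ℕ) : ℕ :=
  Nat.rec 0 (fun s t => bif decide (f (s + 1) = f s) then t else s + 1) n

lemma lastChange_succ (f : ℕ → ℕ) (n : ℕ) :
    lastChange f (n + 1) = if f (n + 1) = f n then lastChange f n else n + 1 := by
  simp only [lastChange, Bool.cond_decide]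

lemma lastChange_le (f : ℕ → ℕ) (n : ℕ) : lastChange f n ≤ n := by
  induction n with
  | zero => rfl
  | succ n ih => rw [lastChange_succ]; split_ifs <;> omega

lemma lastChange_monotone (f : ℕ → ℕ) : Monotone (lastChange f) :=
  monotone_nat_of_le_succ fun n => by
    rw [lastChange_succ]
    have := lastChange_le f n
    split_ifs <;> omega

lemma lastChange_lastChange (f : ℕ → ℕ) (n : ℕ) :
    lastChange f (lastChange f n) = lastChange f n := by
  induction n with
  | zero => rfl
  | succ n ih =>
    by_cases h : f (n + 1) = f n
    · rw [lastChange_succ, if_pos h, ih]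
    · have : lastChange f (n + 1) = n + 1 := by rw [lastChange_succ, if_neg h]
      rw [this, this]

lemma eq_of_lastChange_le (f : ℕ → ℕ) {k n : ℕ} (hk : lastChange f n ≤ k) (hkn : k ≤ n) :
    f k = f n := by
  induction n with
  | zero => rw [Nat.le_zero.1 hkn]
  | succ n ih =>
    rcases hkn.eq_or_lt with rfl | hlt
    · rfl
    · by_cases h : f (n + 1) = f n
      · rw [lastChange_succ, if_pos h] at hk
        rw [h, ih hk (by omega)]
      · rw [lastChange_succ, if_neg h] at hk
        omega

/-- Past the stage `m`, the value `m` can be recovered: it is a modulus of the approximation. -/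
lemma exists_settling {F : ℕ → ℕ → ℕ} (hF : Computable₂ F) {f : ℕ → ℕ}
    (hlim : ∀ w, ∃ t, ∀ s ≥ t, F w s = f w) :
    ∃ T : ℕ → ℕ → ℕ, Computable₂ T ∧ ∀ w, ∃ m ≥ f w, ∀ n ≥ m, T w n = m := by
  refine ⟨fun w n => max (lastChange (F w) n) (F w n), ?_, fun w => ?_⟩
  · have hsucc : Computable fun a : (ℕ × ℕ) × (ℕ × ℕ) => a.2.1 + 1 :=
      Computable.succ.comp (Computable.fst.comp Computable.snd)
    have step : Computable₂ fun (a : ℕ × ℕ) (b : ℕ × ℕ) =>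
        bif decide (F a.1 (b.1 + 1) = F a.1 b.1) then b.2 else b.1 + 1 :=
      Computable.cond (Primrec.eq.decide.to_comp.comp
          (hF.comp (Computable.fst.comp Computable.fst) hsucc)
          (hF.comp (Computable.fst.comp Computable.fst) (Computable.fst.comp Computable.snd)))
        (Computable.snd.comp Computable.snd) hsucc
    exact Primrec.nat_max.to_comp.comp
      (Computable.nat_rec Computable.snd (Computable.const 0) step)
      (hF.comp Computable.fst Computable.snd)
  · obtain ⟨t, ht⟩ := hlim w
    have hval : ∀ n, lastChange (F w) t ≤ n → F w n = f w := fun n hn => by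
      rcases le_total t n with h | h
      · exact ht n h
      · rw [eq_of_lastChange_le _ hn h, ht t le_rfl]
    have hconst : ∀ n, lastChange (F w) t ≤ n → lastChange (F w) n = lastChange (F w) t := by
      intro n hn
      rcases le_total n t with h | h
      · refine le_antisymm (lastChange_monotone _ h) ?_
        simpa only [lastChange_lastChange] using lastChange_monotone (F w) hn
      · clear hn
        induction n, h using Nat.le_induction with
        | base => rfl
        | succ n h ih => rw [lastChange_succ, ht n h, ht (n + 1) (by omega), if_pos rfl, ih]
    refine ⟨max (lastChange (F w) t) (f w), le_max_right _ _, fun n hn => ?_⟩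
    simp only [hconst n ((le_max_left _ _).trans hn), hval n ((le_max_left _ _).trans hn)]

/-- The least `x < k` with `w ≤ h x`, or `k` if there is none. -/
def boundedSearch (h : ℕ → ℕ) (w k : ℕ) : ℕ :=
  Nat.rec 0 (fun _ x => bif decide (w ≤ h x) then x else x + 1) k

lemma boundedSearch_eq {h : ℕ → ℕ} {w x : ℕ} (hlt : ∀ k < x, h k < w) (hx : w ≤ h x) :
    ∀ k, boundedSearch h w k = min k x := by
  intro k
  induction k with
  | zero => simp [boundedSearch]
  | succ k ih =>
    have : boundedSearch h w (k + 1) =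
        if w ≤ h (boundedSearch h w k) then boundedSearch h w k
        else boundedSearch h w k + 1 := by simp only [boundedSearch, Bool.cond_decide]
    rw [this, ih]
    rcases lt_or_ge k x with hk | hk
    · rw [min_eq_left hk.le, if_neg (not_le.2 (hlt k hk))]; omega
    · rw [min_eq_right hk, if_pos hx]; omega

/-- A value at which a `Δ⁰₂` order exceeds `w` can be recovered from any larger number. -/
lemma exists_recoverable {g : ℕ → ℕ} (hg : Delta02Fun g) (ho : IsOrder g) (l : ℕ) :
    ∃ T : ℕ → ℕ → ℕ, Computable₂ T ∧ ∀ w, ∃ m, l ≤ m ∧ w ≤ g m ∧ ∀ n ≥ m, T w n = m := by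
  classical
  obtain ⟨G, hG, hlim⟩ := hg
  have hex : ∀ w, ∃ x, w ≤ g x := fun w => (ho.2 w).imp fun _ => le_of_lt
  have hF : Computable₂ fun w s => max l (boundedSearch (G s) w s) := by
    have step : Computable₂ fun (a : ℕ × ℕ) (b : ℕ × ℕ) =>
        bif decide (a.1 ≤ G a.2 b.2) then b.2 else b.2 + 1 :=
      Computable.cond (Primrec.nat_le.decide.to_comp.comp
          (Computable.fst.comp Computable.fst)
          (hG.comp (Computable.snd.comp Computable.fst) (Computable.snd.comp Computable.snd)))
        (Computable.snd.comp Computable.snd)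
        (Computable.succ.comp (Computable.snd.comp Computable.snd))
    exact Primrec.nat_max.to_comp.comp (Computable.const l)
      (Computable.nat_rec Computable.snd (Computable.const 0) step)
  obtain ⟨T, hT, hm⟩ := exists_settling hF (f := fun w => max l (Nat.find (hex w))) fun w => by
    choose t ht using hlim
    refine ⟨max (Nat.find (hex w)) ((Finset.range (Nat.find (hex w) + 1)).sup t), fun s hs => ?_⟩
    have hGs : ∀ k ≤ Nat.find (hex w), G s k = g k := fun k hk =>
      ht k s ((Finset.le_sup (Finset.mem_range.2 (Nat.lt_succ_of_le hk))).trans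
        ((le_max_right _ _).trans hs))
    rw [boundedSearch_eq (x := Nat.find (hex w)) _ _, min_eq_right ((le_max_left _ _).trans hs)]
    · intro k hk
      rw [hGs k hk.le]
      exact not_le.1 (Nat.find_min (hex w) hk)
    · rw [hGs _ le_rfl]
      exact Nat.find_spec (hex w)
  refine ⟨T, hT, fun w => ?_⟩
  obtain ⟨m, hle, hmT⟩ := hm w
  exact ⟨m, (le_max_left _ _).trans hle,
    (Nat.find_spec (hex w)).trans (ho.1 ((le_max_right _ _).trans hle)), hmT⟩

/-! ### Marked strings -/

/-- Pad `σ` with zeros up to length `m`, then append a marker `1` and the bit `b`. -/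
def mark (σ : BinStr) (b : Bool) (m : ℕ) : BinStr :=
  σ ++ List.replicate (m - σ.length) false ++ [true, b]

/-- The first `n` bits of `σ0^∞`. -/
def padTake (σ : BinStr) (n : ℕ) : BinStr := restrict (fun k => σ.getD k false) n

lemma primrec_padTake : Primrec₂ padTake :=
  Primrec.list_map (Primrec.list_range.comp Primrec.snd)
    ((Primrec.list_getD false).comp (Primrec.fst.comp Primrec.fst) Primrec.snd)

lemma primrec_mark (σ : BinStr) (b : Bool) : Primrec (mark σ b) :=
  Primrec.list_append.comp
    (Primrec.list_append.comp (Primrec.const σ)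
      ((primrec_replicate false).comp (Primrec.nat_sub.comp Primrec.id (Primrec.const _))))
    (Primrec.const [true, b])

lemma length_mark {σ : BinStr} {m : ℕ} (h : σ.length ≤ m) (b : Bool) :
    (mark σ b m).length = m + 2 := by
  simp [mark]; omega

lemma prefix_mark (σ : BinStr) (b : Bool) (m : ℕ) : σ <+: mark σ b m := by
  simp [mark]

lemma restrict_eq_padTake {A : Seq2} {σ : BinStr} {b : Bool} {m n : ℕ} (hm : σ.length ≤ m)
    (hn : n ≤ m) (hA : restrict A (mark σ b m).length = mark σ b m) :
    restrict A n = padTake σ n := by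
  rw [length_mark hm] at hA
  refine restrict_congr fun k hk => ?_
  have hAk : A k = (mark σ b m).getD k false := by
    rw [← hA]
    simp [restrict, List.getElem?_range (show k < m + 2 by omega)]
  rw [hAk]
  rcases lt_or_ge k σ.length with h | h
  · exact prefix_getD (prefix_mark σ b m) h
  · simp [mark, List.getElem?_append_right h, List.getElem?_append_left,
      show k - σ.length < m - σ.length by omega, h]

/-- A code which, when given its own index and any `n ≥ m`, outputs the first `n` bits of the
marked string, where its index is bounded by the value of the given order at `m`. -/
lemma exists_mark_code {g : ℕ → ℕ} (hg : Delta02Fun g) (ho : IsOrder g) (σ : BinStr) (b : Bool) :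
    ∃ (d : Nat.Partrec.Code) (m : ℕ), σ.length ≤ m ∧ Encodable.encode d ≤ g m ∧
      ∀ n ≥ m, d.eval (Nat.pair (Encodable.encode d) n) =
        Part.some (Encodable.encode (padTake (mark σ b m) n)) := by
  obtain ⟨T, hT, hm⟩ := exists_recoverable hg ho σ.length
  have hcomp : Computable fun v : ℕ =>
      Encodable.encode (padTake (mark σ b (T v.unpair.1 v.unpair.2)) v.unpair.2) :=
    Computable.encode.comp <| primrec_padTake.to_comp.comp
      ((primrec_mark σ b).to_comp.comp (hT.comp (Computable.fst.comp Computable.unpair)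
        (Computable.snd.comp Computable.unpair)))
      (Computable.snd.comp Computable.unpair)
  obtain ⟨d, hd⟩ := Nat.Partrec.Code.exists_code.1 (Partrec.nat_iff.1 hcomp)
  obtain ⟨m, hl, hw, hmT⟩ := hm (Encodable.encode d)
  refine ⟨d, m, hl, hw, fun n hn => ?_⟩
  rw [hd]
  simp [hmT n hn]

/-! ### Two oracle machines -/

/-- On a program `1ᵈ0q`, where `U` maps `q` to a string of length `n`, run the code with index `d`
on the pair `(d, n)`. -/
def codeMachine (U : UniversalPrefixMachine) : PrefixOracleMachine where
  axioms s := (U.axioms s.unpair.1).bind fun a =>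
    ((Denumerable.ofNat Nat.Partrec.Code s.unpair.2.unpair.1).evaln s.unpair.2.unpair.2
      (Nat.pair s.unpair.2.unpair.1 a.2.2.length)).bind fun v =>
    (Encodable.decode (α := BinStr) v).bind fun z =>
    some (a.1, unaryCons s.unpair.2.unpair.1 a.2.1, z)
  axioms_computable := by
    have hs : Primrec fun s : ℕ => s.unpair.2.unpair :=
      Primrec.unpair.comp (Primrec.snd.comp Primrec.unpair)
    have hd : Primrec fun s : ℕ => s.unpair.2.unpair.1 := Primrec.fst.comp hs
    have hk : Primrec fun s : ℕ => s.unpair.2.unpair.2 := Primrec.snd.comp hs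
    refine Computable.option_bind
      (U.axioms_computable.comp (Computable.fst.comp Computable.unpair)) (Primrec.to_comp ?_)
    refine Primrec.option_bind (Nat.Partrec.Code.primrec_evaln.comp
      (((hk.comp Primrec.fst).pair ((Primrec.ofNat _).comp (hd.comp Primrec.fst))).pair
        (Primrec₂.natPair.comp (hd.comp Primrec.fst) (Primrec.list_length.comp
          (Primrec.snd.comp (Primrec.snd.comp Primrec.snd)))))) ?_
    refine Primrec.option_bind (Primrec.decode.comp Primrec.snd) ?_
    have h1 : Primrec fun x : ((ℕ × (BinStr × BinStr × BinStr)) × ℕ) × BinStr => x.1.1 :=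
      Primrec.fst.comp Primrec.fst
    have h2 := Primrec.snd.comp h1
    exact Primrec.option_some.comp <| (Primrec.fst.comp h2).pair <|
      (primrec_unaryCons.comp (hd.comp (Primrec.fst.comp h1))
        (Primrec.fst.comp (Primrec.snd.comp h2))).pair Primrec.snd
  consistent := by
    intro s t τ₁ p₁ y₁ τ₂ p₂ y₂ hs ht hτ hp
    simp only [Option.bind_eq_some_iff, Option.some.injEq, Prod.mk.injEq] at hs ht
    obtain ⟨⟨τ, q, x⟩, hUs, v, hv, z, hz, rfl, rfl, rfl⟩ := hs
    obtain ⟨⟨τ', q', x'⟩, hUt, v', hv', z', hz', rfl, rfl, rfl⟩ := ht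
    obtain ⟨hd, hq⟩ := eq_and_prefix_of_unaryCons hp
    obtain ⟨rfl, rfl⟩ := U.consistent _ _ _ _ _ _ _ _ hUs hUt hτ hq
    rw [hd] at hv ⊢
    have hvv : v = v' := Part.mem_unique (Nat.Partrec.Code.evaln_sound hv)
      (Nat.Partrec.Code.evaln_sound hv')
    subst hvv
    exact ⟨rfl, Option.some.inj (hz.symm.trans hz')⟩

lemma exists_Kc_le_of_code (U : UniversalPrefixMachine) :
    ∃ c, ∀ (d : Nat.Partrec.Code) (n : ℕ) (z : BinStr),
      d.eval (Nat.pair (Encodable.encode d) n) = Part.some (Encodable.encode z) →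
      Kc U z ≤ KcNat U n + Encodable.encode d + c := by
  obtain ⟨c, hc⟩ := exists_KOr_le U (codeMachine U)
  refine ⟨c + 1, fun d n z hd => ?_⟩
  obtain ⟨q, hq, s, τ, hs, k, rfl⟩ := exists_program U zeroSeq (List.replicate n false)
  obtain ⟨e, he⟩ := Nat.Partrec.Code.evaln_complete.1 (Part.eq_some_iff.1 hd)
  have := hc zeroSeq (unaryCons (Encodable.encode d) q) z
    ⟨Nat.pair s (Nat.pair (Encodable.encode d) e), restrict zeroSeq k, by
      simp only [codeMachine, Nat.unpair_pair, hs, Option.bind_some, Denumerable.ofNat_encode,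
        List.length_replicate, Option.mem_def.1 he, Encodable.encodek], k, rfl⟩
  rw [length_unaryCons, hq] at this
  unfold KcNat Kc
  omega

/-- One step of `unmark`; the second component records whether a marker has just been read. -/
def unmarkStep (s : BinStr × Bool) (a : Bool) : BinStr × Bool :=
  bif s.2 then (s.1 ++ [a], false) else (s.1, a)

/-- The string of bits following the markers. -/
def unmark (τ : BinStr) : BinStr := (τ.foldl unmarkStep ([], false)).1

lemma primrec_unmark : Primrec unmark := by
  have h1 : Primrec fun x : BinStr × (BinStr × Bool) × Bool => x.2.1 :=
    Primrec.fst.comp Primrec.snd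
  have h2 : Primrec fun x : BinStr × (BinStr × Bool) × Bool => x.2.2 :=
    Primrec.snd.comp Primrec.snd
  refine Primrec.fst.comp (Primrec.list_foldl (h := fun _ x => unmarkStep x.1 x.2) Primrec.id
    (Primrec.const ([], false)) ?_)
  exact Primrec.cond (Primrec.snd.comp h1)
    ((Primrec.list_concat.comp (Primrec.fst.comp h1) h2).pair (Primrec.const false))
    ((Primrec.fst.comp h1).pair h2)

lemma fst_prefix_foldl_unmarkStep (ρ : BinStr) (s : BinStr × Bool) :
    s.1 <+: (ρ.foldl unmarkStep s).1 := by
  induction ρ generalizing s with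
  | nil => exact List.prefix_rfl
  | cons a ρ ih =>
    refine List.IsPrefix.trans ?_ (ih _)
    rcases s with ⟨x, _ | _⟩ <;> simp [unmarkStep]

lemma unmark_mono {σ τ : BinStr} (h : σ <+: τ) : unmark σ <+: unmark τ := by
  obtain ⟨ρ, rfl⟩ := h
  rw [unmark, unmark, List.foldl_append]
  exact fst_prefix_foldl_unmarkStep _ _

lemma foldl_unmarkStep_replicate (n : ℕ) (x : BinStr) :
    (List.replicate n false).foldl unmarkStep (x, false) = (x, false) := by
  induction n with
  | zero => rfl
  | succ n ih => simpa [List.replicate_succ, unmarkStep] using ih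

lemma foldl_unmarkStep_mark {σ x : BinStr}
    (h : σ.foldl unmarkStep ([], false) = (x, false)) (b : Bool) (m : ℕ) :
    (mark σ b m).foldl unmarkStep ([], false) = (x ++ [b], false) := by
  rw [mark, List.foldl_append, List.foldl_append, h, foldl_unmarkStep_replicate]
  rfl

/-- Run `U` with the oracle obtained by `unmark`ing the given one. -/
def unmarkMachine (U : UniversalPrefixMachine) : PrefixOracleMachine where
  axioms s := (U.axioms s.unpair.1).bind fun a =>
    (Encodable.decode (α := BinStr) s.unpair.2).bind fun τ =>
    if a.1 = (unmark τ).take a.1.length then some (τ, a.2) else none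
  axioms_computable := by
    refine Computable.option_bind
      (U.axioms_computable.comp (Computable.fst.comp Computable.unpair)) (Primrec.to_comp ?_)
    refine Primrec.option_bind (Primrec.decode.comp
      (Primrec.snd.comp (Primrec.unpair.comp Primrec.fst))) ?_
    have h1 : Primrec fun x : (ℕ × (BinStr × BinStr × BinStr)) × BinStr => x.1.2 :=
      Primrec.snd.comp Primrec.fst
    have h2 := Primrec.fst.comp h1
    exact Primrec.ite (Primrec.eq.comp h2 (Primrec.list_take.comp (Primrec.list_length.comp h2)
        (primrec_unmark.comp Primrec.snd)))
      (Primrec.option_some.comp (Primrec.snd.pair (Primrec.snd.comp h1))) (Primrec.const none)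
  consistent := by
    intro s t τ₁ p₁ y₁ τ₂ p₂ y₂ hs ht hτ hp
    simp only [Option.bind_eq_some_iff, Option.ite_none_right_eq_some, Option.some.injEq,
      Prod.mk.injEq, ← List.prefix_iff_eq_take] at hs ht
    obtain ⟨⟨σ₁, _⟩, hUs, _, -, h1, rfl, rfl⟩ := hs
    obtain ⟨⟨σ₂, _⟩, hUt, _, -, h2, rfl, rfl⟩ := ht
    refine U.consistent _ _ _ _ _ _ _ _ hUs hUt ?_ hp
    rcases hτ with hτ | hτ
    · exact List.prefix_or_prefix_of_prefix (h1.trans (unmark_mono hτ)) h2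
    · exact List.prefix_or_prefix_of_prefix h1 (h2.trans (unmark_mono hτ))

lemma exists_KOr_le_of_unmark (U : UniversalPrefixMachine) {A B : Seq2}
    (h : ∀ k, ∃ n, restrict B k <+: unmark (restrict A n)) :
    ∃ c, ∀ y, KOr U A y ≤ KOr U B y + c := by
  obtain ⟨c, hc⟩ := exists_KOr_le U (unmarkMachine U)
  refine ⟨c, fun y => ?_⟩
  obtain ⟨q, hq, s, τ, hs, k, rfl⟩ := exists_program U B y
  obtain ⟨n, hn⟩ := h k
  rw [← hq]
  refine hc A q y ⟨Nat.pair s (Encodable.encode (restrict A n)), restrict A n, ?_, n, rfl⟩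
  simp only [unmarkMachine, Nat.unpair_pair, hs, Option.bind_some, Encodable.encodek]
  rw [if_pos (List.prefix_iff_eq_take.1 hn)]

/-! ### Every real is computable from a real in `KT(Δ⁰₂)` -/

lemma countable_Delta02Fun : {g | Delta02Fun g}.Countable := by
  have h : ∀ g : {g | Delta02Fun g}, ∃ c : Nat.Partrec.Code, ∃ G : ℕ → ℕ → ℕ,
      (∀ v, c.eval v = Part.some (G v.unpair.1 v.unpair.2)) ∧
        ∀ x, ∃ t, ∀ s ≥ t, G s x = g.1 x := by
    rintro ⟨g, G, hG, hlim⟩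
    have hcomp : Computable fun v : ℕ => G v.unpair.1 v.unpair.2 :=
      hG.comp (Computable.fst.comp Computable.unpair) (Computable.snd.comp Computable.unpair)
    obtain ⟨c, hc⟩ := Nat.Partrec.Code.exists_code.1 (Partrec.nat_iff.1 hcomp)
    exact ⟨c, G, fun v => by rw [hc]; rfl, hlim⟩
  choose c G hc hlim using h
  refine Function.Injective.countable (f := c) fun g g' hcc => Subtype.ext (funext fun x => ?_)
  obtain ⟨t, ht⟩ := hlim g x
  obtain ⟨t', ht'⟩ := hlim g' x
  have hGG := hc g (Nat.pair (max t t') x)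
  rw [hcc, hc g', Nat.unpair_pair] at hGG
  rw [← ht _ (le_max_left t t'), ← ht' _ (le_max_right t t')]
  exact (Part.some_inj.1 hGG).symm

lemma Delta02Fun.min {g h : ℕ → ℕ} (hg : Delta02Fun g) (hh : Delta02Fun h) :
    Delta02Fun fun x => min (g x) (h x) := by
  obtain ⟨G, hG, hlim⟩ := hg
  obtain ⟨H, hH, hlim'⟩ := hh
  refine ⟨fun s x => Min.min (G s x) (H s x), Primrec.nat_min.to_comp.comp hG hH, fun x => ?_⟩
  obtain ⟨t, ht⟩ := hlim x
  obtain ⟨t', ht'⟩ := hlim' x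
  exact ⟨max t t', fun s hs => by
    dsimp only
    rw [ht s ((le_max_left _ _).trans hs), ht' s ((le_max_right _ _).trans hs)]⟩

lemma IsOrder.min {g h : ℕ → ℕ} (hg : IsOrder g) (hh : IsOrder h) :
    IsOrder fun x => min (g x) (h x) := by
  refine ⟨fun x y hxy => min_le_min (hg.1 hxy) (hh.1 hxy), fun b => ?_⟩
  obtain ⟨x, hx⟩ := hg.2 b
  obtain ⟨y, hy⟩ := hh.2 b
  exact ⟨max x y, lt_min (hx.trans_le (hg.1 (le_max_left _ _)))
    (hy.trans_le (hh.1 (le_max_right _ _)))⟩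

/-- Some sequence of `Δ⁰₂` orders is eventually below each `Δ⁰₂` order. -/
lemma exists_coinitial_orders : ∃ γ : ℕ → ℕ → ℕ,
    (∀ i, Delta02Fun (γ i) ∧ IsOrder (γ i)) ∧
      ∀ g, Delta02Fun g → IsOrder g → ∃ e, ∀ i ≥ e, ∀ n, γ i n ≤ g n := by
  have hid : Delta02Fun id ∧ IsOrder id :=
    ⟨⟨fun _ n => n, Computable.snd, fun _ => ⟨0, fun _ _ => rfl⟩⟩, monotone_id,
      fun b => ⟨b + 1, Nat.lt_succ_self b⟩⟩
  obtain ⟨ε, hε⟩ := (countable_Delta02Fun.mono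
    (fun g (hg : Delta02Fun g ∧ IsOrder g) => hg.1)).exists_eq_range ⟨id, hid⟩
  have hεi : ∀ i, Delta02Fun (ε i) ∧ IsOrder (ε i) := fun i =>
    (Set.ext_iff.1 hε (ε i)).2 ⟨i, rfl⟩
  let γ : ℕ → ℕ → ℕ := fun i => Nat.rec id (fun i h x => min (h x) (ε i x)) i
  have hγ : ∀ i x, γ (i + 1) x = min (γ i x) (ε i x) := fun _ _ => rfl
  refine ⟨γ, fun i => ?_, fun g hg ho => ?_⟩
  · induction i with
    | zero => exact hid
    | succ i ih => exact ⟨ih.1.min (hεi i).1, ih.2.min (hεi i).2⟩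
  · obtain ⟨e, rfl⟩ := (Set.ext_iff.1 hε g).1 ⟨hg, ho⟩
    refine ⟨e + 1, fun i hi n => ?_⟩
    induction i, hi using Nat.le_induction with
    | base => exact (hγ e n).le.trans (min_le_right _ _)
    | succ i _ ih => exact (hγ i n).le.trans ((min_le_left _ _).trans ih)

lemma exists_KTDelta_unmark (U : UniversalPrefixMachine) (B : Seq2) :
    ∃ A, KTDelta U A ∧ ∀ k, ∃ n, restrict B k <+: unmark (restrict A n) := by
  obtain ⟨γ, hγ, hγle⟩ := exists_coinitial_orders
  choose d m hlen hd hout using fun i => exists_mark_code (hγ i).1 (hγ i).2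
  let σ : ℕ → BinStr := fun i => Nat.rec [] (fun i τ => mark τ (B i) (m i τ (B i))) i
  let M : ℕ → ℕ := fun i => m i (σ i) (B i)
  have hσ : ∀ i, σ (i + 1) = mark (σ i) (B i) (M i) := fun _ => rfl
  have hM : ∀ i, (σ i).length ≤ M i := fun i => hlen _ _ _
  have hlenσ : ∀ i, (σ (i + 1)).length = M i + 2 := fun i => by rw [hσ, length_mark (hM i)]
  have hi : ∀ i, i ≤ (σ i).length := fun i => by
    induction i with
    | zero => exact Nat.zero_le _
    | succ i ih => have := hM i; rw [hlenσ]; omega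
  obtain ⟨A, hA⟩ := exists_limit σ (fun i => hσ i ▸ prefix_mark _ _ _) hi
  refine ⟨A, fun g hg ho => ?_, fun k => ⟨(σ k).length, ?_⟩⟩
  · obtain ⟨c, hc⟩ := exists_Kc_le_of_code U
    obtain ⟨e, he⟩ := hγle g hg ho
    refine ⟨c + (Finset.range (M e)).sup fun n => Kc U (restrict A n), fun n => ?_⟩
    rcases lt_or_ge n (M e) with hn | hn
    · have := Finset.le_sup (f := fun n => Kc U (restrict A n)) (Finset.mem_range.2 hn)
      omega
    · have hex : ∃ i, n < M (i + 1) := ⟨n, (hi (n + 1)).trans (hM (n + 1))⟩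
      obtain ⟨i, hei, hin, hni⟩ : ∃ i, e ≤ i ∧ M i ≤ n ∧ n < M (i + 1) := by
        by_contra! hcon
        have : ∀ i ≥ e, M i ≤ n := fun i h => by
          induction i, h using Nat.le_induction with
          | base => exact hn
          | succ i h ih => exact hcon i h ih
        have h1 := this (max e (n + 1)) (le_max_left _ _)
        have h2 := (hi (max e (n + 1))).trans (hM (max e (n + 1)))
        have h3 := le_max_right e (n + 1)
        omega
      have hAn : restrict A n = padTake (σ (i + 1)) n := by
        refine restrict_eq_padTake (hM (i + 1)) hni.le (b := B (i + 1)) ?_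
        exact hA (i + 2)
      have h1 := hc _ n _ (hout i (σ i) (B i) n hin)
      rw [← hσ i, ← hAn] at h1
      have h2 := (hd i (σ i) (B i)).trans ((he i hei _).trans (ho.1 hin))
      omega
  · have : (σ k).foldl unmarkStep ([], false) = (restrict B k, false) := by
      induction k with
      | zero => rfl
      | succ k ih => rw [hσ, foldl_unmarkStep_mark ih, restrict_succ]
    rw [hA k, unmark, this]

/-- no collection F of functions satisfies LK(F) = KT(Δ⁰₂). -/
theorem stmt8 (U : UniversalPrefixMachine) :
    ¬ ∃ F : Set (BinStr → ℕ), ∀ A : Seq2, (∀ f ∈ F, LK U f A) ↔ KTDelta U A := by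
  rintro ⟨F, hF⟩
  obtain ⟨B, hB⟩ := exists_not_KTDelta U
  obtain ⟨A, hA, hAB⟩ := exists_KTDelta_unmark U B
  obtain ⟨c, hc⟩ := exists_KOr_le_of_unmark U hAB
  refine hB ((hF B).1 fun f hf => ?_)
  obtain ⟨c', hc'⟩ := (hF A).2 hA f hf
  refine ⟨c + c', fun y => ?_⟩
  have h1 := hc y
  have h2 := hc' y
  omega
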